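/- arXiv:2109.08929 — 2 statements merged into one kernel-verified Lean document; each statement's English description precedes it below -/
import Mathlib

section
/- Let 2 < α < 4 and assume that there exist a Borel probability measure μ on ℝ and η ∈ ℝ such that the potential φ_α(x) := ∫_ℝ ( α^{-1}|x−y|^α − 2^{-1}|x−y|² ) dμ(y) satisfies φ_α ≥ η on all of ℝ and φ_α = η on the support of μ. Then μ is the unique minimizer (up to translations) of the energy E_α[ν] = (1/2)∬_{ℝ×ℝ}( α^{-1}|x-y|^α − 2^{-1}|x-y|² ) dν(x) dν(y) over Borel probability measures ν on ℝ, and η = 2 E_α where E_α is the minimal energy. -/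
open MeasureTheory Real

/-- The (topological) support of a Borel measure on `ℝ`: the set of points all of whose
neighborhoods have positive measure. -/
def measureSupport (μ : Measure ℝ) : Set ℝ :=
  {x : ℝ | ∀ U ∈ nhds x, μ U ≠ 0}

section Kernel

/-- The attractive-repulsive pair interaction as a function of the displacement. -/
noncomputable def pairInteraction (α u : ℝ) : ℝ := α⁻¹ * |u| ^ α - 2⁻¹ * |u| ^ 2

variable {Ω : Type*} [MeasurableSpace Ω] {m : Measure Ω} {α : ℝ} {f : Ω → ℝ}

lemma integrable_abs_rpow_of_memLp (hα : 0 < α) (hf : MemLp f (ENNReal.ofReal α) m) :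
    Integrable (fun x => |f x| ^ α) m := by
  have h := (integrable_norm_rpow_iff hf.1 (by simpa using hα) (by simp)).2 hf
  simpa [ENNReal.toReal_ofReal hα.le] using h

lemma memLp_two_of_memLp [IsFiniteMeasure m] (hα : 2 < α)
    (hf : MemLp f (ENNReal.ofReal α) m) : MemLp f 2 m :=
  hf.mono_exponent (by simpa using ENNReal.ofReal_le_ofReal hα.le)

lemma integrable_pairInteraction_of_memLp [IsFiniteMeasure m] (hα : 2 < α)
    (hf : MemLp f (ENNReal.ofReal α) m) : Integrable (fun x => pairInteraction α (f x)) m := by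
  unfold pairInteraction
  have h2 := (memLp_two_of_memLp hα hf).integrable_sq
  refine ((integrable_abs_rpow_of_memLp (by linarith) hf).const_mul _).sub (Integrable.const_mul ?_ _)
  simpa using h2

lemma exists_abs_rpow_le_pairInteraction (hα : 2 < α) :
    ∃ C : ℝ, ∀ u : ℝ, |u| ^ α ≤ 2 * α * pairInteraction α u + C := by
  set R : ℝ := α ^ (α - 2)⁻¹ with hR
  have hα0 : 0 < α := by linarith
  have hR0 : 0 < R := Real.rpow_pos_of_pos hα0 _
  have hRα : R ^ (α - 2) = α := Real.rpow_inv_rpow hα0.le (by linarith)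
  refine ⟨α * R ^ 2, fun u => ?_⟩
  have key : α * |u| ^ 2 ≤ |u| ^ α + α * R ^ 2 := by
    rcases le_total |u| R with h | h
    · have : |u| ^ 2 ≤ R ^ 2 := by gcongr
      have := Real.rpow_nonneg (abs_nonneg u) α
      nlinarith
    · have hu : 0 < |u| := hR0.trans_le h
      have h1 : |u| ^ α = |u| ^ (α - 2) * |u| ^ 2 := by
        rw [← Real.rpow_natCast |u| 2, ← Real.rpow_add hu]; norm_num
      have h2 : α ≤ |u| ^ (α - 2) :=
        hRα.symm.le.trans (Real.rpow_le_rpow hR0.le h (by linarith))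
      rw [h1]
      have := mul_le_mul_of_nonneg_right h2 (sq_nonneg |u|)
      nlinarith [mul_nonneg hα0.le (sq_nonneg R)]
  have h3 : 2 * α * pairInteraction α u = 2 * |u| ^ α - α * |u| ^ 2 := by
    unfold pairInteraction; field_simp
  linarith

lemma memLp_of_integrable_pairInteraction [IsFiniteMeasure m] (hα : 2 < α)
    (hf : AEStronglyMeasurable f m) (h : Integrable (fun x => pairInteraction α (f x)) m) :
    MemLp f (ENNReal.ofReal α) m := by
  have hα0 : 0 < α := by linarith
  obtain ⟨C, hC⟩ := exists_abs_rpow_le_pairInteraction hα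
  refine (integrable_norm_rpow_iff hf (by simpa using hα0) (by simp)).1 ?_
  simp only [ENNReal.toReal_ofReal hα0.le]
  refine ((h.const_mul (2 * α)).add (integrable_const C)).mono'
    (hf.norm.aemeasurable.pow_const α).aestronglyMeasurable (.of_forall fun x => ?_)
  rw [Real.norm_of_nonneg (by positivity)]
  exact hC (f x)

end Kernel

section Moments

variable {α : ℝ} {μ ν : Measure ℝ} [IsProbabilityMeasure μ] [IsProbabilityMeasure ν]

lemma memLp_id_of_memLp_sub (x : ℝ) {p : ENNReal} (h : MemLp (fun y => x - y) p μ) :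
    MemLp (fun y : ℝ => y) p μ := by
  simpa [Pi.sub_def] using (memLp_const x).sub h

lemma memLp_fst_sub_snd {p : ENNReal} (hμ : MemLp (fun y : ℝ => y) p μ)
    (hν : MemLp (fun y : ℝ => y) p ν) : MemLp (fun q : ℝ × ℝ => q.1 - q.2) p (μ.prod ν) :=
  (hμ.comp_fst ν).sub (hν.comp_snd μ)

lemma memLp_id_of_integrable_prod (hα : 2 < α)
    (h : Integrable (fun p : ℝ × ℝ => pairInteraction α (p.1 - p.2)) (ν.prod ν)) :
    MemLp (fun y : ℝ => y) (ENNReal.ofReal α) ν := by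
  obtain ⟨x, hx⟩ := h.prod_right_ae.exists
  exact memLp_id_of_memLp_sub x (memLp_of_integrable_pairInteraction hα (by fun_prop) hx)

lemma integral_sub_sq_prod (hμ : MemLp (fun y : ℝ => y) 2 μ) (hν : MemLp (fun y : ℝ => y) 2 ν) :
    ∫ p : ℝ × ℝ, (p.1 - p.2) ^ 2 ∂(μ.prod ν) =
      ∫ x, x ^ 2 ∂μ + ∫ x, x ^ 2 ∂ν - 2 * ((∫ x, x ∂μ) * ∫ x, x ∂ν) := by
  have h1 : Integrable (fun p : ℝ × ℝ => p.1 ^ 2) (μ.prod ν) := hμ.integrable_sq.comp_fst ν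
  have h2 : Integrable (fun p : ℝ × ℝ => p.2 ^ 2) (μ.prod ν) := hν.integrable_sq.comp_snd μ
  have h3 : Integrable (fun p : ℝ × ℝ => 2 * (p.1 * p.2)) (μ.prod ν) :=
    ((hμ.integrable one_le_two).mul_prod (hν.integrable one_le_two)).const_mul 2
  have e : ∀ p : ℝ × ℝ, (p.1 - p.2) ^ 2 = p.1 ^ 2 + p.2 ^ 2 - 2 * (p.1 * p.2) := fun p => by ring
  simp_rw [e]
  rw [integral_sub (h1.fun_add h2) h3, integral_add h1 h2, integral_const_mul,
    integral_prod_mul (fun x : ℝ => x) (fun x : ℝ => x),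
    integral_fun_fst (fun x : ℝ => x ^ 2), integral_fun_snd (fun x : ℝ => x ^ 2)]
  simp

end Moments

section CosineRemainder

/-- The second order Taylor remainder of the cosine at the origin. -/
noncomputable def cosRemainder (u : ℝ) : ℝ := cos u - 1 + u ^ 2 / 2

lemma continuous_cosRemainder : Continuous cosRemainder := by unfold cosRemainder; fun_prop

lemma cosRemainder_nonneg (u : ℝ) : 0 ≤ cosRemainder u := by
  have := @Real.one_sub_sq_div_two_le_cos u
  unfold cosRemainder; linarith

lemma cosRemainder_pos {u : ℝ} (hu : u ≠ 0) : 0 < cosRemainder u := by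
  have := Real.one_sub_sq_div_two_lt_cos hu
  unfold cosRemainder; linarith

lemma cosRemainder_abs (u : ℝ) : cosRemainder |u| = cosRemainder u := by simp [cosRemainder]

lemma cosRemainder_le_sq (u : ℝ) : cosRemainder u ≤ u ^ 2 := by
  have := Real.cos_le_one u
  unfold cosRemainder; nlinarith [sq_nonneg u]

lemma cosRemainder_le_pow_four {u : ℝ} (hu : |u| ≤ 1) : cosRemainder u ≤ |u| ^ 4 := by
  have h := (abs_le.1 (Real.cos_bound hu)).2
  have : 0 ≤ |u| ^ 4 := by positivity
  unfold cosRemainder; linarith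

variable {α : ℝ}

lemma integrableOn_rpow_mul_cosRemainder (h2 : 2 < α) (h4 : α < 4) :
    IntegrableOn (fun t : ℝ => t ^ (-1 - α) * cosRemainder t) (Set.Ioi 0) := by
  have hm : Measurable (fun t : ℝ => t ^ (-1 - α) * cosRemainder t) :=
    (measurable_id.pow_const _).mul continuous_cosRemainder.measurable
  rw [← Set.Ioc_union_Ioi_eq_Ioi (zero_le_one' ℝ)]
  refine IntegrableOn.union ?_ ?_
  · have hi : IntegrableOn (fun t : ℝ => t ^ (3 - α)) (Set.Ioc 0 1) :=
      (intervalIntegrable_iff_integrableOn_Ioc_of_le zero_le_one).1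
        (intervalIntegral.intervalIntegrable_rpow' (by linarith))
    refine hi.mono' hm.aestronglyMeasurable ?_
    filter_upwards [ae_restrict_mem measurableSet_Ioc] with t ht
    have ht0 : 0 < t := ht.1
    have e : t ^ (3 - α) = t ^ (-1 - α) * |t| ^ 4 := by
      rw [abs_of_pos ht0, ← Real.rpow_natCast t 4, ← Real.rpow_add ht0]
      congr 1; push_cast; ring
    rw [Real.norm_of_nonneg (mul_nonneg (by positivity) (cosRemainder_nonneg t)), e]
    gcongr
    exact cosRemainder_le_pow_four (abs_le.2 ⟨by linarith, ht.2⟩)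
  · have hi : IntegrableOn (fun t : ℝ => t ^ (1 - α)) (Set.Ioi 1) :=
      integrableOn_Ioi_rpow_of_lt (by linarith) one_pos
    refine hi.mono' hm.aestronglyMeasurable ?_
    filter_upwards [ae_restrict_mem measurableSet_Ioi] with t ht
    have ht0 : 0 < t := one_pos.trans ht
    have e : t ^ (1 - α) = t ^ (-1 - α) * t ^ 2 := by
      rw [← Real.rpow_natCast t 2, ← Real.rpow_add ht0]
      congr 1; push_cast; ring
    rw [Real.norm_of_nonneg (mul_nonneg (by positivity) (cosRemainder_nonneg t)), e]
    gcongr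
    exact cosRemainder_le_sq t

lemma integral_rpow_mul_cosRemainder_pos (h2 : 2 < α) (h4 : α < 4) :
    0 < ∫ t in Set.Ioi (0 : ℝ), t ^ (-1 - α) * cosRemainder t := by
  rw [setIntegral_pos_iff_support_of_nonneg_ae _ (integrableOn_rpow_mul_cosRemainder h2 h4)]
  · have : Function.support (fun t : ℝ => t ^ (-1 - α) * cosRemainder t) ∩ Set.Ioi 0
        = Set.Ioi 0 := by
      refine Set.inter_eq_right.2 fun t (ht : 0 < t) => ?_
      exact (mul_pos (Real.rpow_pos_of_pos ht _) (cosRemainder_pos ht.ne')).ne'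
    rw [this]; simp
  · filter_upwards [ae_restrict_mem measurableSet_Ioi] with t ht
    exact mul_nonneg (Real.rpow_nonneg (le_of_lt ht) _) (cosRemainder_nonneg t)

lemma rpow_mul_cosRemainder_comp_mul {v t : ℝ} (hv : 0 < v) (ht : 0 < t) :
    t ^ (-1 - α) * cosRemainder (v * t) =
      v ^ (1 + α) * ((v * t) ^ (-1 - α) * cosRemainder (v * t)) := by
  rw [Real.mul_rpow hv.le ht.le, ← mul_assoc, ← mul_assoc, ← Real.rpow_add hv]
  simp

lemma integrableOn_rpow_mul_cosRemainder_mul (h2 : 2 < α) (h4 : α < 4) (u : ℝ) :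
    IntegrableOn (fun t : ℝ => t ^ (-1 - α) * cosRemainder (t * u)) (Set.Ioi 0) := by
  rcases eq_or_ne u 0 with rfl | hu
  · simp [cosRemainder]
  have hv : 0 < |u| := abs_pos.2 hu
  have h := ((integrableOn_Ioi_comp_mul_left_iff
    (fun t : ℝ => t ^ (-1 - α) * cosRemainder t) 0 hv).2
      (by simpa using integrableOn_rpow_mul_cosRemainder h2 h4)).const_mul (|u| ^ (1 + α))
  refine IntegrableOn.congr_fun h (fun t (ht : 0 < t) => ?_) measurableSet_Ioi
  rw [← rpow_mul_cosRemainder_comp_mul hv ht, ← cosRemainder_abs (t * u), abs_mul, abs_of_pos ht,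
    mul_comm t]

lemma integral_rpow_mul_cosRemainder_mul (h2 : 2 < α) (u : ℝ) :
    ∫ t in Set.Ioi (0 : ℝ), t ^ (-1 - α) * cosRemainder (t * u) =
      (∫ t in Set.Ioi (0 : ℝ), t ^ (-1 - α) * cosRemainder t) * |u| ^ α := by
  rcases eq_or_ne u 0 with rfl | hu
  · simp [cosRemainder, Real.zero_rpow (by linarith : α ≠ 0)]
  have hv : 0 < |u| := abs_pos.2 hu
  have e : ∫ t in Set.Ioi (0 : ℝ), t ^ (-1 - α) * cosRemainder (t * u) =
      ∫ t in Set.Ioi (0 : ℝ),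
        |u| ^ (1 + α) * ((|u| * t) ^ (-1 - α) * cosRemainder (|u| * t)) := by
    refine setIntegral_congr_fun measurableSet_Ioi fun t (ht : 0 < t) => ?_
    rw [← rpow_mul_cosRemainder_comp_mul hv ht, ← cosRemainder_abs (t * u), abs_mul,
      abs_of_pos ht, mul_comm t]
  rw [e, integral_const_mul,
    integral_comp_mul_left_Ioi (fun t : ℝ => t ^ (-1 - α) * cosRemainder t) 0 hv,
    Real.rpow_add hv, Real.rpow_one]
  simp only [mul_zero, smul_eq_mul]
  field_simp

end CosineRemainder

section Fourier

variable {α : ℝ} {μ ν : Measure ℝ} [IsProbabilityMeasure μ] [IsProbabilityMeasure ν]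

lemma re_charFun (t : ℝ) : (charFun μ t).re = ∫ x, cos (t * x) ∂μ := by
  rw [charFun_apply_real, ← RCLike.re_eq_complex_re, ← integral_re]
  · congr with x
    rw [RCLike.re_eq_complex_re, ← Complex.ofReal_mul, Complex.exp_ofReal_mul_I_re]
  · refine (integrable_const (1 : ℝ)).mono' (by fun_prop) (.of_forall fun x => ?_)
    rw [← Complex.ofReal_mul, Complex.norm_exp_ofReal_mul_I]

lemma im_charFun (t : ℝ) : (charFun μ t).im = ∫ x, sin (t * x) ∂μ := by
  rw [charFun_apply_real, ← RCLike.im_eq_complex_im, ← integral_im]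
  · congr with x
    rw [RCLike.im_eq_complex_im, ← Complex.ofReal_mul, Complex.exp_ofReal_mul_I_im]
  · refine (integrable_const (1 : ℝ)).mono' (by fun_prop) (.of_forall fun x => ?_)
    rw [← Complex.ofReal_mul, Complex.norm_exp_ofReal_mul_I]

lemma integral_cosRemainder_prod (hμ : MemLp (fun y : ℝ => y) 2 μ)
    (hν : MemLp (fun y : ℝ => y) 2 ν) (t : ℝ) :
    ∫ p : ℝ × ℝ, cosRemainder (t * (p.1 - p.2)) ∂(μ.prod ν) =
      (charFun μ t).re * (charFun ν t).re + (charFun μ t).im * (charFun ν t).im - 1 +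
        t ^ 2 / 2 *
          (∫ x, x ^ 2 ∂μ + ∫ x, x ^ 2 ∂ν - 2 * ((∫ x, x ∂μ) * ∫ x, x ∂ν)) := by
  have hc (ρ : Measure ℝ) [IsProbabilityMeasure ρ] : Integrable (fun x => cos (t * x)) ρ :=
    (integrable_const (1 : ℝ)).mono' (by fun_prop)
      (.of_forall fun x => by simpa using Real.abs_cos_le_one _)
  have hs (ρ : Measure ℝ) [IsProbabilityMeasure ρ] : Integrable (fun x => sin (t * x)) ρ :=
    (integrable_const (1 : ℝ)).mono' (by fun_prop)
      (.of_forall fun x => by simpa using Real.abs_sin_le_one _)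
  have h1 := (hc μ).mul_prod (hc ν)
  have h2 := (hs μ).mul_prod (hs ν)
  have h3 : Integrable (fun p : ℝ × ℝ => t ^ 2 / 2 * (p.1 - p.2) ^ 2) (μ.prod ν) :=
    (memLp_fst_sub_snd hμ hν).integrable_sq.const_mul _
  have e : ∀ p : ℝ × ℝ, cosRemainder (t * (p.1 - p.2)) =
      cos (t * p.1) * cos (t * p.2) + sin (t * p.1) * sin (t * p.2) +
        t ^ 2 / 2 * (p.1 - p.2) ^ 2 - 1 := fun p => by
    rw [cosRemainder, mul_sub, Real.cos_sub]; ring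
  simp_rw [e]
  rw [integral_sub (Integrable.fun_add (h1.fun_add h2) h3) (integrable_const 1),
    integral_add (h1.fun_add h2) h3, integral_add h1 h2, integral_const_mul,
    integral_prod_mul (fun x => cos (t * x)) (fun x => cos (t * x)),
    integral_prod_mul (fun x => sin (t * x)) (fun x => sin (t * x)),
    integral_sub_sq_prod hμ hν, re_charFun, re_charFun, im_charFun, im_charFun]
  simp only [integral_const, probReal_univ, smul_eq_mul]
  ring

lemma integrable_prod_rpow_mul_cosRemainder (h2 : 2 < α) (h4 : α < 4)
    (hμ : MemLp (fun y : ℝ => y) (ENNReal.ofReal α) μ)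
    (hν : MemLp (fun y : ℝ => y) (ENNReal.ofReal α) ν) :
    Integrable (fun q : (ℝ × ℝ) × ℝ => q.2 ^ (-1 - α) * cosRemainder (q.2 * (q.1.1 - q.1.2)))
      ((μ.prod ν).prod (volume.restrict (Set.Ioi 0))) := by
  have hm : Measurable
      (fun q : (ℝ × ℝ) × ℝ => q.2 ^ (-1 - α) * cosRemainder (q.2 * (q.1.1 - q.1.2))) :=
    (measurable_snd.pow_const _).mul (continuous_cosRemainder.measurable.comp
      (measurable_snd.mul (measurable_fst.fst.sub measurable_fst.snd)))
  have hnorm (p : ℝ × ℝ) :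
      ∫ t in Set.Ioi (0 : ℝ), ‖t ^ (-1 - α) * cosRemainder (t * (p.1 - p.2))‖ =
        (∫ t in Set.Ioi (0 : ℝ), t ^ (-1 - α) * cosRemainder t) * |p.1 - p.2| ^ α := by
    rw [← integral_rpow_mul_cosRemainder_mul h2]
    refine setIntegral_congr_fun measurableSet_Ioi fun t (ht : 0 < t) => ?_
    exact Real.norm_of_nonneg (mul_nonneg (Real.rpow_nonneg ht.le _) (cosRemainder_nonneg _))
  rw [integrable_prod_iff hm.aestronglyMeasurable]
  constructor
  · exact .of_forall fun p => integrableOn_rpow_mul_cosRemainder_mul h2 h4 (p.1 - p.2)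
  · simp only [hnorm]
    exact (integrable_abs_rpow_of_memLp (by linarith) (memLp_fst_sub_snd hμ hν)).const_mul _

lemma integrableOn_rpow_mul_integral_cosRemainder (h2 : 2 < α) (h4 : α < 4)
    (hμ : MemLp (fun y : ℝ => y) (ENNReal.ofReal α) μ)
    (hν : MemLp (fun y : ℝ => y) (ENNReal.ofReal α) ν) :
    IntegrableOn (fun t : ℝ => t ^ (-1 - α) *
      ∫ p : ℝ × ℝ, cosRemainder (t * (p.1 - p.2)) ∂(μ.prod ν)) (Set.Ioi 0) := by
  simpa [integral_const_mul, IntegrableOn] using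
    (integrable_prod_rpow_mul_cosRemainder h2 h4 hμ hν).integral_prod_right

lemma integral_rpow_mul_integral_cosRemainder (h2 : 2 < α) (h4 : α < 4)
    (hμ : MemLp (fun y : ℝ => y) (ENNReal.ofReal α) μ)
    (hν : MemLp (fun y : ℝ => y) (ENNReal.ofReal α) ν) :
    ∫ t in Set.Ioi (0 : ℝ), t ^ (-1 - α) *
        ∫ p : ℝ × ℝ, cosRemainder (t * (p.1 - p.2)) ∂(μ.prod ν) =
      (∫ t in Set.Ioi (0 : ℝ), t ^ (-1 - α) * cosRemainder t) *
        ∫ p : ℝ × ℝ, |p.1 - p.2| ^ α ∂(μ.prod ν) := by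
  have h := integral_integral_swap (f := fun (p : ℝ × ℝ) (t : ℝ) =>
    t ^ (-1 - α) * cosRemainder (t * (p.1 - p.2)))
    (integrable_prod_rpow_mul_cosRemainder h2 h4 hμ hν)
  simp_rw [integral_rpow_mul_cosRemainder_mul h2, integral_const_mul] at h
  exact h.symm

/-- The power kernel with exponent in `(2, 4)` is positive definite on differences of probability
measures with the same mean. The difference of energies is a weighted `L²` norm of the difference
of the characteristic functions. -/
lemma integral_normSq_charFun_sub (h2 : 2 < α) (h4 : α < 4)
    (hμ : MemLp (fun y : ℝ => y) (ENNReal.ofReal α) μ)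
    (hν : MemLp (fun y : ℝ => y) (ENNReal.ofReal α) ν) (hmean : ∫ x, x ∂ν = ∫ x, x ∂μ) :
    IntegrableOn (fun t : ℝ => t ^ (-1 - α) * Complex.normSq (charFun ν t - charFun μ t))
      (Set.Ioi 0) ∧
    ∫ t in Set.Ioi (0 : ℝ), t ^ (-1 - α) * Complex.normSq (charFun ν t - charFun μ t) =
      (∫ t in Set.Ioi (0 : ℝ), t ^ (-1 - α) * cosRemainder t) *
        (∫ p : ℝ × ℝ, |p.1 - p.2| ^ α ∂(ν.prod ν) + ∫ p : ℝ × ℝ, |p.1 - p.2| ^ α ∂(μ.prod μ)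
          - 2 * ∫ p : ℝ × ℝ, |p.1 - p.2| ^ α ∂(ν.prod μ)) := by
  have hμ2 := memLp_two_of_memLp h2 hμ
  have hν2 := memLp_two_of_memLp h2 hν
  have i1 := integrableOn_rpow_mul_integral_cosRemainder h2 h4 hν hν
  have i2 := integrableOn_rpow_mul_integral_cosRemainder h2 h4 hμ hμ
  have i3 := (integrableOn_rpow_mul_integral_cosRemainder h2 h4 hν hμ).const_mul 2
  have e : (fun t : ℝ => t ^ (-1 - α) * Complex.normSq (charFun ν t - charFun μ t)) =
      fun t : ℝ => t ^ (-1 - α) * ∫ p : ℝ × ℝ, cosRemainder (t * (p.1 - p.2)) ∂(ν.prod ν) +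
        t ^ (-1 - α) * ∫ p : ℝ × ℝ, cosRemainder (t * (p.1 - p.2)) ∂(μ.prod μ) -
        2 * (t ^ (-1 - α) * ∫ p : ℝ × ℝ, cosRemainder (t * (p.1 - p.2)) ∂(ν.prod μ)) := by
    funext t
    rw [integral_cosRemainder_prod hν2 hν2, integral_cosRemainder_prod hμ2 hμ2,
      integral_cosRemainder_prod hν2 hμ2, hmean, Complex.normSq_apply, Complex.sub_re,
      Complex.sub_im]
    ring
  rw [e]
  refine ⟨(i1.add i2).sub i3, ?_⟩
  rw [integral_sub (i1.integrable.fun_add i2) i3, integral_add i1 i2, integral_const_mul,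
    integral_rpow_mul_integral_cosRemainder h2 h4 hν hν,
    integral_rpow_mul_integral_cosRemainder h2 h4 hμ hμ,
    integral_rpow_mul_integral_cosRemainder h2 h4 hν hμ]
  ring

lemma eq_of_charFun_eq_on_pos (h : Set.EqOn (charFun ν) (charFun μ) (Set.Ioi 0)) : ν = μ := by
  refine Measure.ext_of_charFun (funext fun t => ?_)
  rcases lt_trichotomy t 0 with ht | rfl | ht
  · rw [← neg_neg t, charFun_neg, charFun_neg (-t), h (Set.mem_Ioi.2 (neg_pos.2 ht))]
  · simp
  · exact h ht

lemma rpow_energy_strictly_convex (h2 : 2 < α) (h4 : α < 4)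
    (hμ : MemLp (fun y : ℝ => y) (ENNReal.ofReal α) μ)
    (hν : MemLp (fun y : ℝ => y) (ENNReal.ofReal α) ν) (hmean : ∫ x, x ∂ν = ∫ x, x ∂μ) :
    0 ≤ ∫ p : ℝ × ℝ, |p.1 - p.2| ^ α ∂(ν.prod ν) + ∫ p : ℝ × ℝ, |p.1 - p.2| ^ α ∂(μ.prod μ)
          - 2 * ∫ p : ℝ × ℝ, |p.1 - p.2| ^ α ∂(ν.prod μ) ∧
    (∫ p : ℝ × ℝ, |p.1 - p.2| ^ α ∂(ν.prod ν) + ∫ p : ℝ × ℝ, |p.1 - p.2| ^ α ∂(μ.prod μ)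
          - 2 * ∫ p : ℝ × ℝ, |p.1 - p.2| ^ α ∂(ν.prod μ) = 0 → ν = μ) := by
  obtain ⟨hi, he⟩ := integral_normSq_charFun_sub h2 h4 hμ hν hmean
  have hpos := integral_rpow_mul_cosRemainder_pos h2 h4
  have hnn : 0 ≤ᵐ[volume.restrict (Set.Ioi (0 : ℝ))]
      fun t : ℝ => t ^ (-1 - α) * Complex.normSq (charFun ν t - charFun μ t) := by
    filter_upwards [ae_restrict_mem measurableSet_Ioi] with t ht
    exact mul_nonneg (Real.rpow_nonneg (le_of_lt ht) _) (Complex.normSq_nonneg _)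
  refine ⟨nonneg_of_mul_nonneg_right (he ▸ integral_nonneg_of_ae hnn) hpos, fun h0 => ?_⟩
  rw [h0, mul_zero, setIntegral_eq_zero_iff_of_nonneg_ae hnn hi] at he
  refine eq_of_charFun_eq_on_pos (Measure.eqOn_open_of_ae_eq (μ := volume) ?_ isOpen_Ioi
    continuous_charFun.continuousOn continuous_charFun.continuousOn)
  filter_upwards [he, ae_restrict_mem measurableSet_Ioi] with t ht ht0
  have := (mul_eq_zero.1 ht).resolve_left (Real.rpow_pos_of_pos ht0 _).ne'
  exact sub_eq_zero.1 (Complex.normSq_eq_zero.1 this)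

lemma integral_pairInteraction_prod (h2 : 2 < α)
    (hμ : MemLp (fun y : ℝ => y) (ENNReal.ofReal α) μ)
    (hν : MemLp (fun y : ℝ => y) (ENNReal.ofReal α) ν) :
    ∫ p : ℝ × ℝ, pairInteraction α (p.1 - p.2) ∂(μ.prod ν) =
      α⁻¹ * ∫ p : ℝ × ℝ, |p.1 - p.2| ^ α ∂(μ.prod ν) -
        2⁻¹ * (∫ x, x ^ 2 ∂μ + ∫ x, x ^ 2 ∂ν - 2 * ((∫ x, x ∂μ) * ∫ x, x ∂ν)) := by
  have hsub := memLp_fst_sub_snd hμ hν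
  have hsq := (memLp_two_of_memLp h2 hsub).integrable_sq
  simp_rw [pairInteraction, sq_abs]
  rw [integral_sub ((integrable_abs_rpow_of_memLp (by linarith) hsub).const_mul _)
      (hsq.const_mul _), integral_const_mul, integral_const_mul,
    integral_sub_sq_prod (memLp_two_of_memLp h2 hμ) (memLp_two_of_memLp h2 hν)]

lemma pairInteraction_energy_strictly_convex (h2 : 2 < α) (h4 : α < 4)
    (hμ : MemLp (fun y : ℝ => y) (ENNReal.ofReal α) μ)
    (hν : MemLp (fun y : ℝ => y) (ENNReal.ofReal α) ν) (hmean : ∫ x, x ∂ν = ∫ x, x ∂μ) :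
    0 ≤ ∫ p : ℝ × ℝ, pairInteraction α (p.1 - p.2) ∂(ν.prod ν) +
          ∫ p : ℝ × ℝ, pairInteraction α (p.1 - p.2) ∂(μ.prod μ)
          - 2 * ∫ p : ℝ × ℝ, pairInteraction α (p.1 - p.2) ∂(ν.prod μ) ∧
    (∫ p : ℝ × ℝ, pairInteraction α (p.1 - p.2) ∂(ν.prod ν) +
          ∫ p : ℝ × ℝ, pairInteraction α (p.1 - p.2) ∂(μ.prod μ)
          - 2 * ∫ p : ℝ × ℝ, pairInteraction α (p.1 - p.2) ∂(ν.prod μ) = 0 → ν = μ) := by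
  obtain ⟨hnn, heq⟩ := rpow_energy_strictly_convex h2 h4 hμ hν hmean
  have hα : 0 < α⁻¹ := inv_pos.2 (by linarith)
  rw [integral_pairInteraction_prod h2 hν hν, integral_pairInteraction_prod h2 hμ hμ,
    integral_pairInteraction_prod h2 hν hμ, hmean]
  refine ⟨by linarith [mul_nonneg hα.le hnn], fun h => heq ?_⟩
  exact (mul_eq_zero.1 (by linarith : α⁻¹ * _ = 0)).resolve_left hα.ne'

end Fourier

section Translation

variable {α : ℝ} {ν : Measure ℝ} [IsProbabilityMeasure ν]

lemma integral_prod_map_add (a : ℝ) (g : ℝ → ℝ) (hg : Measurable g) :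
    ∫ p : ℝ × ℝ, g (p.1 - p.2) ∂((ν.map (· + a)).prod (ν.map (· + a))) =
      ∫ p : ℝ × ℝ, g (p.1 - p.2) ∂(ν.prod ν) := by
  have hm : Measurable (fun x : ℝ => x + a) := by fun_prop
  have hgm : Measurable (fun p : ℝ × ℝ => g (p.1 - p.2)) := by fun_prop
  rw [Measure.map_prod_map ν ν hm hm, integral_map (hm.prodMap hm).aemeasurable
    hgm.aestronglyMeasurable]
  simp [Prod.map]

lemma measurable_pairInteraction : Measurable (pairInteraction α) := by
  unfold pairInteraction
  exact ((measurable_abs.pow_const α).const_mul _).sub ((measurable_abs.pow_const 2).const_mul _)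

end Translation

section EulerLagrange

variable {α : ℝ} {μ ν : Measure ℝ} [IsProbabilityMeasure μ] [IsProbabilityMeasure ν] {η : ℝ}

lemma measureSupport_mem_ae (μ : Measure ℝ) : measureSupport μ ∈ ae μ := by
  convert (Measure.support_mem_ae (μ := μ)) using 1
  ext x
  simp [measureSupport, Measure.mem_support_iff_forall, pos_iff_ne_zero]

lemma le_integral_prod_of_le_potential (h2 : 2 < α)
    (hμ : MemLp (fun y : ℝ => y) (ENNReal.ofReal α) μ)
    (hν : MemLp (fun y : ℝ => y) (ENNReal.ofReal α) ν)
    (hge : ∀ x : ℝ, η ≤ ∫ y, pairInteraction α (x - y) ∂μ) :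
    η ≤ ∫ p : ℝ × ℝ, pairInteraction α (p.1 - p.2) ∂(ν.prod μ) := by
  have hi := integrable_pairInteraction_of_memLp h2 (memLp_fst_sub_snd hν hμ)
  rw [integral_prod _ hi]
  simpa using integral_mono (integrable_const η) hi.integral_prod_left hge

lemma integral_prod_self_eq_of_potential_eq (h2 : 2 < α)
    (hμ : MemLp (fun y : ℝ => y) (ENNReal.ofReal α) μ)
    (heq : ∀ x ∈ measureSupport μ, ∫ y, pairInteraction α (x - y) ∂μ = η) :
    ∫ p : ℝ × ℝ, pairInteraction α (p.1 - p.2) ∂(μ.prod μ) = η := by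
  rw [integral_prod _ (integrable_pairInteraction_of_memLp h2 (memLp_fst_sub_snd hμ hμ)),
    integral_congr_ae (g := fun _ => η) (by
      filter_upwards [measureSupport_mem_ae μ] with x hx using heq x hx)]
  simp

lemma exists_translate_energy_comparison (h2 : 2 < α) (h4 : α < 4)
    (hμ : MemLp (fun y : ℝ => y) (ENNReal.ofReal α) μ)
    (hν : MemLp (fun y : ℝ => y) (ENNReal.ofReal α) ν)
    (hge : ∀ x : ℝ, η ≤ ∫ y, pairInteraction α (x - y) ∂μ)
    (heq : ∀ x ∈ measureSupport μ, ∫ y, pairInteraction α (x - y) ∂μ = η) :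
    η ≤ ∫ p : ℝ × ℝ, pairInteraction α (p.1 - p.2) ∂(ν.prod ν) ∧
    (∫ p : ℝ × ℝ, pairInteraction α (p.1 - p.2) ∂(ν.prod ν) = η →
      ∃ a : ℝ, ν = μ.map (fun x => x + a)) := by
  set a : ℝ := ∫ x, x ∂μ - ∫ x, x ∂ν with ha
  have hm : Measurable (fun x : ℝ => x + a) := by fun_prop
  have hprob : IsProbabilityMeasure (ν.map (· + a)) :=
    Measure.isProbabilityMeasure_map hm.aemeasurable
  have hν' : MemLp (fun y : ℝ => y) (ENNReal.ofReal α) (ν.map (· + a)) :=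
    (memLp_map_measure_iff (by fun_prop) hm.aemeasurable).2 (hν.add (memLp_const a))
  have hmean : ∫ x, x ∂(ν.map (· + a)) = ∫ x, x ∂μ := by
    rw [integral_map hm.aemeasurable (by fun_prop), integral_add
      ((memLp_two_of_memLp h2 hν).integrable one_le_two) (integrable_const a)]
    simp [ha]
  obtain ⟨hnn, h0⟩ := pairInteraction_energy_strictly_convex h2 h4 hμ hν' hmean
  rw [integral_prod_map_add a _ measurable_pairInteraction,
    integral_prod_self_eq_of_potential_eq h2 hμ heq] at hnn h0
  have hcross := le_integral_prod_of_le_potential h2 hμ hν' hge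
  refine ⟨by linarith, fun h => ⟨-a, ?_⟩⟩
  rw [← h0 (by linarith), Measure.map_map (by fun_prop) hm]
  have : (fun x : ℝ => x + -a) ∘ (fun x => x + a) = id := by ext x; simp
  rw [this, Measure.map_id]

end EulerLagrange

/-- Lemma 2.1, Lopes-type convexity argument. Let `2 < α < 4` and suppose
that the potential `φ_α(x) = ∫ (α⁻¹ |x-y|^α - 2⁻¹ |x-y|²) dμ(y)` of a Borel probability
measure `μ` satisfies `φ_α ≥ η` on `ℝ` and `φ_α = η` on `supp μ`. Then `μ` is the unique
minimizer (up to translations) of the energy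
`E_α[ν] = (1/2) ∬ (α⁻¹ |x-y|^α - 2⁻¹ |x-y|²) dν(x) dν(y)` over probability measures `ν`,
and `η = 2 E_α`. -/
theorem unique_minimizer_of_euler_lagrange_two_lt_alpha_lt_four
    (α : ℝ) (hα2 : 2 < α) (hα4 : α < 4)
    (μ : Measure ℝ) (hμ : IsProbabilityMeasure μ) (η : ℝ)
    (hInt : ∀ x : ℝ, Integrable (fun y => α⁻¹ * |x - y| ^ α - 2⁻¹ * |x - y| ^ 2) μ)
    (hge : ∀ x : ℝ, η ≤ ∫ y, (α⁻¹ * |x - y| ^ α - 2⁻¹ * |x - y| ^ 2) ∂μ)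
    (heq : ∀ x ∈ measureSupport μ,
      ∫ y, (α⁻¹ * |x - y| ^ α - 2⁻¹ * |x - y| ^ 2) ∂μ = η) :
    Integrable (fun p : ℝ × ℝ => α⁻¹ * |p.1 - p.2| ^ α - 2⁻¹ * |p.1 - p.2| ^ 2) (μ.prod μ) ∧
    IsLeast {e : ℝ | ∃ ν : Measure ℝ, IsProbabilityMeasure ν ∧
      Integrable (fun p : ℝ × ℝ => α⁻¹ * |p.1 - p.2| ^ α - 2⁻¹ * |p.1 - p.2| ^ 2) (ν.prod ν) ∧
      e = (1 / 2) * ∫ p : ℝ × ℝ,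
        (α⁻¹ * |p.1 - p.2| ^ α - 2⁻¹ * |p.1 - p.2| ^ 2) ∂(ν.prod ν)}
      ((1 / 2) * ∫ p : ℝ × ℝ,
        (α⁻¹ * |p.1 - p.2| ^ α - 2⁻¹ * |p.1 - p.2| ^ 2) ∂(μ.prod μ)) ∧
    (∀ ν : Measure ℝ, IsProbabilityMeasure ν →
      Integrable (fun p : ℝ × ℝ => α⁻¹ * |p.1 - p.2| ^ α - 2⁻¹ * |p.1 - p.2| ^ 2) (ν.prod ν) →
      (1 / 2) * ∫ p : ℝ × ℝ,
          (α⁻¹ * |p.1 - p.2| ^ α - 2⁻¹ * |p.1 - p.2| ^ 2) ∂(ν.prod ν) =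
        (1 / 2) * ∫ p : ℝ × ℝ,
          (α⁻¹ * |p.1 - p.2| ^ α - 2⁻¹ * |p.1 - p.2| ^ 2) ∂(μ.prod μ) →
      ∃ a : ℝ, ν = μ.map (fun x => x + a)) ∧
    η = 2 * ((1 / 2) * ∫ p : ℝ × ℝ,
      (α⁻¹ * |p.1 - p.2| ^ α - 2⁻¹ * |p.1 - p.2| ^ 2) ∂(μ.prod μ)) := by
  have hμα : MemLp (fun y : ℝ => y) (ENNReal.ofReal α) μ :=
    memLp_id_of_memLp_sub 0 (memLp_of_integrable_pairInteraction hα2 (by fun_prop) (hInt 0))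
  have hself := integral_prod_self_eq_of_potential_eq hα2 hμα heq
  have hi := integrable_pairInteraction_of_memLp hα2 (memLp_fst_sub_snd hμα hμα)
  have hcomp (ν : Measure ℝ) (_ : IsProbabilityMeasure ν)
      (h : Integrable (fun p : ℝ × ℝ => pairInteraction α (p.1 - p.2)) (ν.prod ν)) :=
    exists_translate_energy_comparison hα2 hα4 hμα (memLp_id_of_integrable_prod hα2 h) hge heq
  simp only [pairInteraction] at hself hi hcomp
  refine ⟨hi, ⟨⟨μ, hμ, hi, rfl⟩, ?_⟩, fun ν hν h he => (hcomp ν hν h).2 (by linarith), by linarith⟩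
  rintro e ⟨ν, hν, h, rfl⟩
  linarith [(hcomp ν hν h).1]
end

section
/- Let 2 < α < 3 and let R_α = ( (√π/2) · Γ((3-α)/2)/Γ((4-α)/2) · sin((α-1)π/2)/((α-1)π/2) )^{1/(α-2)}. Define the measure dμ(x) = C_α^{-1} R_α^{α-2} (R_α² − x²)^{−(α−1)/2} 𝟙(|x| < R_α) dx, where C_α = √π Γ((3-α)/2)/Γ((4-α)/2). Then μ is a Borel probability measure on ℝ, and the potential φ_α(x) := ∫_ℝ ( α^{-1}|x−y|^α − 2^{-1}|x−y|² ) dμ(y) satisfies φ_α(x) ≥ η for all x ∈ ℝ and φ_α(x) = η for all x in the support of μ, where η = −((α−2)/(α(4−α))) R_α². -/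
open MeasureTheory Real

lemma beta_integral_Ioo {p q : ℝ} (hp : 0 < p) (hq : 0 < q) :
    ∫ s in Set.Ioo (0:ℝ) 1, s ^ (p - 1) * (1 - s) ^ (q - 1) = ProbabilityTheory.beta p q := by
  have hb := ProbabilityTheory.beta_pos hp hq
  have h1 := ProbabilityTheory.lintegral_betaPDF_eq_one hp hq
  have hnn : 0 ≤ᵐ[volume] ProbabilityTheory.betaPDFReal p q := by
    refine Filter.Eventually.of_forall fun x => ?_
    by_cases h : 0 < x ∧ x < 1
    · exact (ProbabilityTheory.betaPDFReal_pos h.1 h.2 hp hq).le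
    · simp [ProbabilityTheory.betaPDFReal, h]
  have hm := ProbabilityTheory.measurable_betaPDFReal p q
  have hI : ∫ x, ProbabilityTheory.betaPDFReal p q x = 1 := by
    rw [integral_eq_lintegral_of_nonneg_ae hnn hm.aestronglyMeasurable]
    change (∫⁻ x, ProbabilityTheory.betaPDF p q x).toReal = 1
    rw [h1]; rfl
  have heq : ProbabilityTheory.betaPDFReal p q = (Set.Ioo 0 1).indicator
      (fun s : ℝ => (ProbabilityTheory.beta p q)⁻¹ * (s ^ (p - 1) * (1 - s) ^ (q - 1))) := by
    ext x
    simp [ProbabilityTheory.betaPDFReal, Set.indicator_apply, mul_assoc]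
  rw [heq, integral_indicator measurableSet_Ioo, integral_const_mul] at hI
  field_simp at hI
  exact hI

lemma even_beta_integral {r q : ℝ} (hr : -1 < r) (hq : 0 < q) :
    IntegrableOn (fun y : ℝ => |y| ^ r * (1 - y ^ 2) ^ (q - 1)) (Set.Ioo (-1) 1) ∧
    ∫ y in Set.Ioo (-1:ℝ) 1, |y| ^ r * (1 - y ^ 2) ^ (q - 1) =
      ProbabilityTheory.beta ((r + 1) / 2) q := by
  have h2 := beta_integral_Ioo (p := (r + 1) / 2) (q := q) (by linarith) hq
  have himg : (fun y : ℝ => y ^ 2) '' Set.Ioo 0 1 = Set.Ioo 0 1 := by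
    ext s
    constructor
    · rintro ⟨y, ⟨hy0, hy1⟩, rfl⟩
      exact ⟨by positivity, by simp only; nlinarith⟩
    · rintro ⟨hs0, hs1⟩
      refine ⟨√s, ⟨Real.sqrt_pos.2 hs0, ?_⟩, Real.sq_sqrt hs0.le⟩
      rw [Real.sqrt_lt' one_pos]; simpa
  have hd : ∀ y ∈ Set.Ioo (0:ℝ) 1,
      HasDerivWithinAt (fun y : ℝ => y ^ 2) (2 * y) (Set.Ioo 0 1) y := fun y _ => by
    simpa using (hasDerivAt_pow 2 y).hasDerivWithinAt
  have hinj : Set.InjOn (fun y : ℝ => y ^ 2) (Set.Ioo 0 1) := by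
    intro a ha b hb hab
    exact (pow_left_inj₀ ha.1.le hb.1.le two_ne_zero).1 hab
  have hcongr : ∀ y ∈ Set.Ioo (0:ℝ) 1,
      |2 * y| • ((y ^ 2) ^ ((r + 1) / 2 - 1) * (1 - y ^ 2) ^ (q - 1)) =
        2 * (|y| ^ r * (1 - y ^ 2) ^ (q - 1)) := by
    intro y hy
    have : (y ^ 2) ^ ((r + 1) / 2 - 1) = y ^ (r - 1) := by
      rw [← Real.rpow_natCast, ← Real.rpow_mul hy.1.le]
      congr 1; push_cast; ring
    rw [this, abs_of_pos (by linarith [hy.1] : 0 < 2 * y), abs_of_pos hy.1,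
      Real.rpow_sub_one hy.1.ne', smul_eq_mul]
    have := hy.1.ne'
    field_simp
  have h4 := integral_image_eq_integral_abs_deriv_smul measurableSet_Ioo hd hinj
    (fun s : ℝ => s ^ ((r + 1) / 2 - 1) * (1 - s) ^ (q - 1))
  rw [himg] at h4
  rw [h2, setIntegral_congr_fun measurableSet_Ioo hcongr, integral_const_mul] at h4
  have hind : (fun y : ℝ => (Set.Ioo (-1) 1).indicator
      (fun y : ℝ => |y| ^ r * (1 - y ^ 2) ^ (q - 1)) y) = fun y => (Set.Iio 1).indicator
      (fun y : ℝ => |y| ^ r * (1 - y ^ 2) ^ (q - 1)) |y| := by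
    ext y
    simp only [Set.indicator_apply, Set.mem_Ioo, Set.mem_Iio, ← abs_lt, abs_abs, sq_abs]
  have hset : Set.Ioi (0:ℝ) ∩ Set.Iio 1 = Set.Ioo 0 1 := Set.Ioi_inter_Iio
  have hval : ∫ y in Set.Ioo (-1:ℝ) 1, |y| ^ r * (1 - y ^ 2) ^ (q - 1) =
      ProbabilityTheory.beta ((r + 1) / 2) q := by
    rw [← integral_indicator measurableSet_Ioo, hind, integral_comp_abs,
      setIntegral_indicator measurableSet_Iio, hset, h4]
  refine ⟨?_, hval⟩
  by_contra h
  have hpos := ProbabilityTheory.beta_pos (α := (r + 1) / 2) (by linarith) hq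
  rw [← hval, integral_undef h] at hpos
  exact hpos.false

/-- The angle `θ` solving `sin (θ - ψ) = x cos ψ`. -/
noncomputable def rieszAngle (x ψ : ℝ) : ℝ := ψ + arcsin (x * cos ψ)

lemma sq_mul_cos_lt_one {x : ℝ} (hx : |x| < 1) (ψ : ℝ) : (x * cos ψ) ^ 2 < 1 := by
  have h1 : x ^ 2 < 1 := (sq_lt_one_iff_abs_lt_one x).2 hx
  nlinarith [cos_sq_le_one ψ, sq_nonneg x, sq_nonneg (cos ψ)]

lemma mul_cos_mem_Ioo {x : ℝ} (hx : |x| < 1) (ψ : ℝ) : x * cos ψ ∈ Set.Ioo (-1 : ℝ) 1 :=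
  abs_lt.1 ((sq_lt_one_iff_abs_lt_one _).1 (sq_mul_cos_lt_one hx ψ))

lemma abs_rieszAngle_slope_lt_one {x : ℝ} (hx : |x| < 1) (ψ : ℝ) :
    |x * sin ψ / √(1 - (x * cos ψ) ^ 2)| < 1 := by
  have h1 : x ^ 2 < 1 := (sq_lt_one_iff_abs_lt_one x).2 hx
  have h2 : 0 < 1 - (x * cos ψ) ^ 2 := by linarith [sq_mul_cos_lt_one hx ψ]
  rw [← sq_lt_one_iff_abs_lt_one, div_pow, Real.sq_sqrt h2.le, div_lt_one h2]
  nlinarith [sin_sq_add_cos_sq ψ]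

lemma hasDerivAt_rieszAngle {x : ℝ} (hx : |x| < 1) (ψ : ℝ) :
    HasDerivAt (rieszAngle x) (1 - x * sin ψ / √(1 - (x * cos ψ) ^ 2)) ψ := by
  have hm := mul_cos_mem_Ioo hx ψ
  have h := (hasDerivAt_id ψ).add
    ((hasDerivAt_arcsin hm.1.ne' hm.2.ne).comp ψ ((hasDerivAt_cos ψ).const_mul x))
  have heq : 1 + 1 / √(1 - (x * cos ψ) ^ 2) * (x * -sin ψ) =
      1 - x * sin ψ / √(1 - (x * cos ψ) ^ 2) := by ring
  exact heq ▸ h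

lemma strictMono_rieszAngle {x : ℝ} (hx : |x| < 1) : StrictMono (rieszAngle x) :=
  strictMono_of_deriv_pos fun ψ => by
    rw [(hasDerivAt_rieszAngle hx ψ).deriv]
    linarith [(abs_lt.1 (abs_rieszAngle_slope_lt_one hx ψ)).2]

lemma rieszAngle_mem_Ioo {x ψ : ℝ} (hx : |x| < 1) (hψ : ψ ∈ Set.Ioo (-(π / 2)) (π / 2)) :
    rieszAngle x ψ ∈ Set.Ioo (-(π / 2)) (π / 2) := by
  have h1 := strictMono_rieszAngle hx hψ.1
  have h2 := strictMono_rieszAngle hx hψ.2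
  simp only [rieszAngle, cos_neg, cos_pi_div_two, mul_zero, arcsin_zero, add_zero] at h1 h2
  exact ⟨h1, h2⟩

lemma strictMonoOn_sin_rieszAngle {x : ℝ} (hx : |x| < 1) :
    StrictMonoOn (fun ψ => sin (rieszAngle x ψ)) (Set.Icc (-(π / 2)) (π / 2)) := by
  refine strictMonoOn_sin.comp ((strictMono_rieszAngle hx).strictMonoOn _) fun ψ hψ => ?_
  have h1 := (strictMono_rieszAngle hx).monotone hψ.1
  have h2 := (strictMono_rieszAngle hx).monotone hψ.2
  simp only [rieszAngle, cos_neg, cos_pi_div_two, mul_zero, arcsin_zero, add_zero] at h1 h2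
  exact ⟨h1, h2⟩

lemma image_sin_rieszAngle {x : ℝ} (hx : |x| < 1) :
    (fun ψ => sin (rieszAngle x ψ)) '' Set.Ioo (-(π / 2)) (π / 2) = Set.Ioo (-1) 1 := by
  have hc : Continuous (fun ψ => sin (rieszAngle x ψ)) := by
    unfold rieszAngle; fun_prop
  have hle : -(π / 2) ≤ π / 2 := by linarith [pi_pos]
  have := (strictMonoOn_sin_rieszAngle hx).image_Ioo_subset
  have h2 := intermediate_value_Ioo hle hc.continuousOn
  simp only [rieszAngle, cos_neg, cos_pi_div_two, mul_zero, arcsin_zero, add_zero, sin_neg,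
    sin_pi_div_two] at this h2 ⊢
  exact this.antisymm h2

lemma sin_rieszAngle_sub {x ψ : ℝ} (hx : |x| < 1) (hψ : ψ ∈ Set.Ioo (-(π / 2)) (π / 2)) :
    sin (rieszAngle x ψ) - x = tan ψ * cos (rieszAngle x ψ) := by
  have hm := mul_cos_mem_Ioo hx ψ
  have hc : cos ψ ≠ 0 := (cos_pos_of_mem_Ioo hψ).ne'
  have h : sin (rieszAngle x ψ - ψ) = x * cos ψ := by
    rw [rieszAngle, add_sub_cancel_left, sin_arcsin hm.1.le hm.2.le]
  rw [sin_sub] at h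
  rw [tan_eq_sin_div_cos]
  field_simp
  linarith

lemma riesz_integrand_comp {a x ψ : ℝ} (hx : |x| < 1)
    (hψ : ψ ∈ Set.Ioo (-(π / 2)) (π / 2)) :
    |cos (rieszAngle x ψ) * (1 - x * sin ψ / √(1 - (x * cos ψ) ^ 2))| •
      (|x - sin (rieszAngle x ψ)| ^ a * (1 - sin (rieszAngle x ψ) ^ 2) ^ (-(a + 1) / 2)) =
    |tan ψ| ^ a * (1 - x * sin ψ / √(1 - (x * cos ψ) ^ 2)) := by
  have hc := cos_pos_of_mem_Ioo (rieszAngle_mem_Ioo hx hψ)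
  have hs := (abs_lt.1 (abs_rieszAngle_slope_lt_one hx ψ)).2
  rw [abs_mul, abs_of_pos hc, abs_of_pos (sub_pos.2 hs), abs_sub_comm, sin_rieszAngle_sub hx hψ,
    abs_mul, abs_of_pos hc, mul_rpow (abs_nonneg _) hc.le, ← cos_sq',
    ← Real.rpow_natCast (cos (rieszAngle x ψ)) 2, ← Real.rpow_mul hc.le, smul_eq_mul]
  have : cos (rieszAngle x ψ) * cos (rieszAngle x ψ) ^ a *
      cos (rieszAngle x ψ) ^ (((2:ℕ):ℝ) * (-(a + 1) / 2)) = 1 := by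
    nth_rw 1 [← Real.rpow_one (cos (rieszAngle x ψ))]
    rw [← Real.rpow_add hc, ← Real.rpow_add hc]
    convert Real.rpow_zero _ using 2
    push_cast
    ring
  linear_combination (|tan ψ| ^ a * (1 - x * sin ψ / √(1 - (x * cos ψ) ^ 2))) * this

lemma hasDerivWithinAt_sin_rieszAngle {x : ℝ} (hx : |x| < 1) (s : Set ℝ) (ψ : ℝ) :
    HasDerivWithinAt (fun ψ => sin (rieszAngle x ψ))
      (cos (rieszAngle x ψ) * (1 - x * sin ψ / √(1 - (x * cos ψ) ^ 2))) s ψ :=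
  (hasDerivAt_rieszAngle hx ψ).sin.hasDerivWithinAt

lemma injOn_sin_rieszAngle {x : ℝ} (hx : |x| < 1) :
    Set.InjOn (fun ψ => sin (rieszAngle x ψ)) (Set.Ioo (-(π / 2)) (π / 2)) :=
  (strictMonoOn_sin_rieszAngle hx).injOn.mono Set.Ioo_subset_Icc_self

lemma integrableOn_abs_tan_rpow {a : ℝ} (ha : -1 < a) (ha1 : a < 1) :
    IntegrableOn (fun ψ => |tan ψ| ^ a) (Set.Ioo (-(π / 2)) (π / 2)) := by
  have h0 : |(0 : ℝ)| < 1 := by simp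
  have h := (even_beta_integral (r := a) (q := (1 - a) / 2) ha (by linarith)).1
  rw [← image_sin_rieszAngle h0, integrableOn_image_iff_integrableOn_abs_deriv_smul
    measurableSet_Ioo (fun ψ _ => hasDerivWithinAt_sin_rieszAngle h0 _ ψ)
    (injOn_sin_rieszAngle h0)] at h
  refine (integrableOn_congr_fun (fun ψ hψ => ?_) measurableSet_Ioo).1 h
  have := riesz_integrand_comp (a := a) h0 hψ
  rw [show (1 - a) / 2 - 1 = -(a + 1) / 2 by ring]
  simpa using this

lemma setIntegral_Ioo_eq_zero_of_odd {f : ℝ → ℝ} (hf : ∀ x, f (-x) = -f x) (c : ℝ) :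
    ∫ x in Set.Ioo (-c) c, f x = 0 := by
  rw [← integral_indicator measurableSet_Ioo]
  have h := integral_neg_eq_self ((Set.Ioo (-c) c).indicator f) volume
  have h2 : ∀ x, (Set.Ioo (-c) c).indicator f (-x) = -(Set.Ioo (-c) c).indicator f x := by
    intro x
    simp only [Set.indicator_apply, Set.mem_Ioo, ← abs_lt, abs_neg, hf]
    split_ifs <;> simp
  simp only [h2, integral_neg] at h
  linarith

lemma riesz_integral_eq {a x : ℝ} (ha : -1 < a) (ha1 : a < 1) (hx : |x| < 1) :
    ∫ y in Set.Ioo (-1 : ℝ) 1, |x - y| ^ a * (1 - y ^ 2) ^ (-(a + 1) / 2) =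
      ∫ ψ in Set.Ioo (-(π / 2)) (π / 2), |tan ψ| ^ a := by
  have hint := integrableOn_abs_tan_rpow ha ha1
  rw [← image_sin_rieszAngle hx, integral_image_eq_integral_abs_deriv_smul
    measurableSet_Ioo (fun ψ _ => hasDerivWithinAt_sin_rieszAngle hx _ ψ)
    (injOn_sin_rieszAngle hx),
    setIntegral_congr_fun measurableSet_Ioo (fun ψ hψ => riesz_integrand_comp hx hψ)]
  have hmul : IntegrableOn (fun ψ => |tan ψ| ^ a * (x * sin ψ / √(1 - (x * cos ψ) ^ 2)))
      (Set.Ioo (-(π / 2)) (π / 2)) := by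
    refine hint.mul_bdd (c := 1) (Measurable.aestronglyMeasurable (by fun_prop)) (Filter.Eventually.of_forall fun ψ => ?_)
    exact (abs_rieszAngle_slope_lt_one hx ψ).le
  have hodd := setIntegral_Ioo_eq_zero_of_odd
    (f := fun ψ => |tan ψ| ^ a * (x * sin ψ / √(1 - (x * cos ψ) ^ 2)))
    (fun ψ => by simp [tan_neg, neg_div]) (π / 2)
  simp only [mul_sub, mul_one]
  rw [integral_sub hint hmul, hodd, sub_zero]

lemma riesz_integral_eq_beta {a x : ℝ} (ha : -1 < a) (ha1 : a < 1) (hx : |x| < 1) :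
    ∫ y in Set.Ioo (-1 : ℝ) 1, |x - y| ^ a * (1 - y ^ 2) ^ (-(a + 1) / 2) =
      ProbabilityTheory.beta ((a + 1) / 2) ((1 - a) / 2) := by
  rw [riesz_integral_eq ha ha1 hx, ← riesz_integral_eq (x := 0) ha ha1 (by simp),
    ← (even_beta_integral (r := a) (q := (1 - a) / 2) ha (by linarith)).2]
  simp only [zero_sub, abs_neg, show (1 - a) / 2 - 1 = -(a + 1) / 2 by ring]

section Convolution

variable {μ : Measure ℝ} [IsFiniteMeasure μ] {R : ℝ}

lemma exists_bound_comp_sub {k : ℝ → ℝ} (hk : Continuous k) (R x₀ : ℝ) :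
    ∃ C, ∀ x ∈ Metric.ball x₀ 1, ∀ y, |y| ≤ R → ‖k (x - y)‖ ≤ C := by
  obtain ⟨C, hC⟩ := (isCompact_closedBall (0 : ℝ) (|x₀| + 1 + R)).exists_bound_of_continuousOn
    hk.continuousOn
  refine ⟨C, fun x hx y hy => hC _ ?_⟩
  rw [Metric.mem_ball, Real.dist_eq] at hx
  rw [mem_closedBall_zero_iff, Real.norm_eq_abs]
  rw [abs_lt] at hx
  rw [abs_le] at hy ⊢
  constructor <;> linarith [neg_abs_le x₀, le_abs_self x₀]

lemma integrable_comp_sub_of_continuous (hμ : ∀ᵐ y ∂μ, |y| ≤ R) {k : ℝ → ℝ} (hk : Continuous k)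
    (x : ℝ) : Integrable (fun y => k (x - y)) μ := by
  obtain ⟨C, hC⟩ := exists_bound_comp_sub hk R x
  refine Integrable.of_bound (by fun_prop) C ?_
  filter_upwards [hμ] with y hy using hC x (Metric.mem_ball_self one_pos) y hy

lemma continuous_integral_comp_sub (hμ : ∀ᵐ y ∂μ, |y| ≤ R) {k : ℝ → ℝ} (hk : Continuous k) :
    Continuous fun x => ∫ y, k (x - y) ∂μ := by
  refine continuous_iff_continuousAt.2 fun x => ?_
  obtain ⟨C, hC⟩ := exists_bound_comp_sub hk R x
  refine continuousAt_of_dominated (bound := fun _ => C)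
    (Filter.Eventually.of_forall fun x => by fun_prop) ?_ (integrable_const C)
    (Filter.Eventually.of_forall fun y => by fun_prop)
  filter_upwards [Metric.ball_mem_nhds x one_pos] with z hz
  filter_upwards [hμ] with y hy using hC z hz y hy

lemma hasDerivAt_integral_comp_sub (hμ : ∀ᵐ y ∂μ, |y| ≤ R) {k k' : ℝ → ℝ}
    (hk : ∀ z, HasDerivAt k (k' z) z) (hk' : Continuous k') (x : ℝ) :
    HasDerivAt (fun x => ∫ y, k (x - y) ∂μ) (∫ y, k' (x - y) ∂μ) x := by
  have hkc : Continuous k := continuous_iff_continuousAt.2 fun z => (hk z).continuousAt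
  obtain ⟨C, hC⟩ := exists_bound_comp_sub hk' R x
  refine (hasDerivAt_integral_of_dominated_loc_of_deriv_le (F := fun x y => k (x - y))
    (F' := fun x y => k' (x - y)) (bound := fun _ => C) (Metric.ball_mem_nhds x one_pos)
    (Filter.Eventually.of_forall fun x => by fun_prop)
    (integrable_comp_sub_of_continuous hμ hkc x) (by fun_prop) ?_ (integrable_const C)
    (Filter.Eventually.of_forall fun y z _ => (hk (z - y)).comp_sub_const z y)).2
  filter_upwards [hμ] with y hy z hz using hC z hz y hy

end Convolution

lemma hasDerivAt_abs_rpow_mul_self {a : ℝ} (ha : 0 < a) (z : ℝ) :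
    HasDerivAt (fun z : ℝ => |z| ^ a * z) ((a + 1) * |z| ^ a) z := by
  have hc : Continuous fun z : ℝ => |z| ^ a := continuous_abs.rpow_const fun _ => Or.inr ha.le
  have hne : ∀ z : ℝ, z ≠ 0 → HasDerivAt (fun z : ℝ => |z| ^ a * z) ((a + 1) * |z| ^ a) z := by
    intro z hz
    have hz' : |z| ≠ 0 := abs_ne_zero.2 hz
    have h := ((hasDerivAt_abs hz).rpow_const (p := a) (Or.inl hz')).mul (hasDerivAt_id z)
    refine h.congr_deriv ?_
    rw [Real.rpow_sub_one hz']
    have hs : (SignType.sign z : ℝ) * z = |z| := sign_mul_self z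
    simp only [id]
    field_simp
    linear_combination a * hs
  by_cases hz : z = 0
  · subst hz
    exact hasDerivAt_of_hasDerivAt_of_ne (g := fun z : ℝ => (a + 1) * |z| ^ a)
      hne (by fun_prop) (continuous_const.mul hc).continuousAt
  · exact hne z hz

/-- A function whose second derivative is nonnegative, vanishes on `(-R, R)`, and whose first
derivative vanishes at `0`, attains its minimum on all of `[-R, R]`. -/
lemma min_and_const_of_second_deriv {U U' U'' : ℝ → ℝ} {R : ℝ} (hR : 0 < R)
    (hU : ∀ x, HasDerivAt U (U' x) x) (hU' : ∀ x, HasDerivAt U' (U'' x) x)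
    (hnn : ∀ x, 0 ≤ U'' x) (hz : ∀ x, |x| < R → U'' x = 0) (h0 : U' 0 = 0) :
    (∀ x, U 0 ≤ U x) ∧ ∀ x, |x| ≤ R → U x = U 0 := by
  have hcU : Continuous U := continuous_iff_continuousAt.2 fun z => (hU z).continuousAt
  have hmono : Monotone U' :=
    monotone_of_deriv_nonneg (fun x => (hU' x).differentiableAt) fun x => by
      rw [(hU' x).deriv]; exact hnn x
  have hconst : ∀ {f f' : ℝ → ℝ}, (∀ x, HasDerivAt f (f' x) x) →
      (∀ x, |x| < R → f' x = 0) → ∀ x, |x| < R → f x = f 0 := by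
    intro f f' hf hf' x hx
    refine isOpen_Ioo.is_const_of_deriv_eq_zero (s := Set.Ioo (-R) R) isPreconnected_Ioo
      (fun x _ => (hf x).differentiableAt.differentiableWithinAt) (fun x hx => ?_)
      (abs_lt.1 hx) ⟨by linarith, hR⟩
    rw [(hf x).deriv]
    exact hf' x (abs_lt.2 hx)
  have hU'z : ∀ x, |x| < R → U' x = 0 := fun x hx => (hconst hU' hz x hx).trans h0
  constructor
  · intro x
    rcases le_total 0 x with hx | hx
    · refine monotoneOn_of_deriv_nonneg (convex_Ici 0) hcU.continuousOn
        (fun x _ => (hU x).differentiableAt.differentiableWithinAt) (fun x hx => ?_)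
        Set.self_mem_Ici hx hx
      rw [interior_Ici] at hx
      rw [(hU x).deriv, ← h0]
      exact hmono (le_of_lt hx)
    · refine antitoneOn_of_deriv_nonpos (convex_Iic 0) hcU.continuousOn
        (fun x _ => (hU x).differentiableAt.differentiableWithinAt) (fun x hx => ?_)
        hx Set.self_mem_Iic hx
      rw [interior_Iic] at hx
      rw [(hU x).deriv, ← h0]
      exact hmono (le_of_lt hx)
  · have hcl : closure (Set.Ioo (-R) R) ⊆ {x | U x = U 0} :=
      closure_minimal (fun x hx => hconst hU hU'z x (abs_lt.2 hx))
        (isClosed_eq hcU continuous_const)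
    rw [closure_Ioo (by linarith)] at hcl
    exact fun x hx => hcl (abs_le.1 hx)


section Beta

variable {α : ℝ}

lemma beta_half_eq (α : ℝ) : ProbabilityTheory.beta (1 / 2) ((3 - α) / 2) =
    √π * Real.Gamma ((3 - α) / 2) / Real.Gamma ((4 - α) / 2) := by
  rw [ProbabilityTheory.beta, Real.Gamma_one_half_eq]
  congr 2
  ring

lemma beta_three_halves_eq (hα3 : α < 3) : ProbabilityTheory.beta (3 / 2) ((3 - α) / 2) =
    ProbabilityTheory.beta (1 / 2) ((3 - α) / 2) / (4 - α) := by
  have h1 : Real.Gamma (3 / 2) = 1 / 2 * Real.Gamma (1 / 2) := by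
    rw [← Real.Gamma_add_one (by norm_num)]; norm_num
  have h2 : Real.Gamma (3 / 2 + (3 - α) / 2) =
      (4 - α) / 2 * Real.Gamma (1 / 2 + (3 - α) / 2) := by
    rw [show (3 : ℝ) / 2 + (3 - α) / 2 = (4 - α) / 2 + 1 by ring,
      Real.Gamma_add_one (by linarith), show (1 : ℝ) / 2 + (3 - α) / 2 = (4 - α) / 2 by ring]
  have h3 : Real.Gamma (1 / 2 + (3 - α) / 2) ≠ 0 := (Real.Gamma_pos_of_pos (by linarith)).ne'
  have h4 : 4 - α ≠ 0 := by linarith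
  rw [ProbabilityTheory.beta, ProbabilityTheory.beta, h1, h2]
  field_simp

lemma beta_sub_one_half_eq (α : ℝ) : ProbabilityTheory.beta ((α - 1) / 2) ((3 - α) / 2) =
    π / sin ((α - 1) * π / 2) := by
  have h := Real.Gamma_mul_Gamma_one_sub ((α - 1) / 2)
  rw [ProbabilityTheory.beta, show (α - 1) / 2 + (3 - α) / 2 = 1 by ring, Real.Gamma_one, div_one,
    show (3 - α) / 2 = 1 - (α - 1) / 2 by ring, h]
  congr 2
  ring

lemma beta_add_one_half_eq (hα1 : 1 < α) : ProbabilityTheory.beta ((α + 1) / 2) ((3 - α) / 2) =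
    (α - 1) / 2 * ProbabilityTheory.beta ((α - 1) / 2) ((3 - α) / 2) := by
  have h : Real.Gamma ((α + 1) / 2) = (α - 1) / 2 * Real.Gamma ((α - 1) / 2) := by
    rw [← Real.Gamma_add_one (by linarith)]; ring_nf
  rw [ProbabilityTheory.beta, ProbabilityTheory.beta, h,
    show (α + 1) / 2 + (3 - α) / 2 = 1 + 1 by ring, show (α - 1) / 2 + (3 - α) / 2 = 1 by ring,
    Real.Gamma_add_one one_ne_zero, Real.Gamma_one]
  ring

end Beta

/-- The density of the candidate minimizer. -/
noncomputable def rieszDensity (α R C x : ℝ) : ℝ :=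
  if |x| < R then C⁻¹ * R ^ (α - 2) * (R ^ 2 - x ^ 2) ^ (-(α - 1) / 2) else 0

lemma measurable_rieszDensity (α R C : ℝ) : Measurable (rieszDensity α R C) :=
  Measurable.ite (measurableSet_lt (by fun_prop) (by fun_prop)) (by fun_prop) (by fun_prop)

lemma rieszDensity_nonneg {α R C : ℝ} (hR : 0 < R) (hC : 0 < C) (x : ℝ) :
    0 ≤ rieszDensity α R C x := by
  unfold rieszDensity
  split_ifs with h
  · have : 0 ≤ R ^ 2 - x ^ 2 := by
      have := sq_lt_sq' (abs_lt.1 h).1 (abs_lt.1 h).2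
      linarith
    positivity
  · exact le_rfl

lemma rieszDensity_mul {α R C : ℝ} (hR : 0 < R) (t : ℝ) :
    rieszDensity α R C (R * t) = R⁻¹ * (Set.Ioo (-1) 1).indicator
      (fun t => C⁻¹ * (1 - t ^ 2) ^ (-(α - 1) / 2)) t := by
  have hiff : |R * t| < R ↔ t ∈ Set.Ioo (-1 : ℝ) 1 := by
    rw [abs_mul, abs_of_pos hR, Set.mem_Ioo, ← abs_lt]
    exact mul_lt_iff_lt_one_right hR
  simp only [rieszDensity, hiff, Set.indicator_apply]
  split_ifs with h
  · have ht : 0 ≤ 1 - t ^ 2 := by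
      have := sq_lt_one_iff_abs_lt_one t |>.2 (abs_lt.2 h)
      linarith
    have hpow : R ^ (α - 2) * (R ^ 2) ^ (-(α - 1) / 2) = R⁻¹ := by
      rw [← Real.rpow_natCast, ← Real.rpow_mul hR.le, ← Real.rpow_add hR, ← Real.rpow_neg_one]
      congr 1
      push_cast
      ring
    rw [show R ^ 2 - (R * t) ^ 2 = R ^ 2 * (1 - t ^ 2) by ring, mul_rpow (by positivity) ht]
    linear_combination (C⁻¹ * (1 - t ^ 2) ^ (-(α - 1) / 2)) * hpow
  · simp

lemma integral_rieszDensity_mul {α R C : ℝ} (hR : 0 < R) (f : ℝ → ℝ) :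
    ∫ x, rieszDensity α R C x * f x =
      C⁻¹ * ∫ t in Set.Ioo (-1 : ℝ) 1, f (R * t) * (1 - t ^ 2) ^ (-(α - 1) / 2) := by
  have h := Measure.integral_comp_mul_left (fun x => rieszDensity α R C x * f x) R
  rw [abs_of_pos (inv_pos.2 hR), smul_eq_mul] at h
  have h2 : ∀ t, rieszDensity α R C (R * t) * f (R * t) = R⁻¹ * (C⁻¹ *
      (Set.Ioo (-1) 1).indicator (fun t => f (R * t) * (1 - t ^ 2) ^ (-(α - 1) / 2)) t) := by
    intro t
    rw [rieszDensity_mul hR]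
    simp only [Set.indicator_apply]
    split_ifs <;> ring
  simp only [h2, integral_const_mul, integral_indicator measurableSet_Ioo] at h
  exact (mul_left_cancel₀ (inv_pos.2 hR).ne' h).symm

/-- The measure with density `rieszDensity`. -/
noncomputable def rieszMeasure (α R C : ℝ) : Measure ℝ :=
  volume.withDensity fun x => ENNReal.ofReal (rieszDensity α R C x)

lemma integral_rieszMeasure {α R C : ℝ} (hR : 0 < R) (hC : 0 < C) (f : ℝ → ℝ) :
    ∫ x, f x ∂(rieszMeasure α R C) =
      C⁻¹ * ∫ t in Set.Ioo (-1 : ℝ) 1, f (R * t) * (1 - t ^ 2) ^ (-(α - 1) / 2) := by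
  rw [← integral_rieszDensity_mul hR, rieszMeasure, integral_withDensity_eq_integral_toReal_smul
    (measurable_rieszDensity α R C).ennreal_ofReal (by simp)]
  simp [ENNReal.toReal_ofReal (rieszDensity_nonneg hR hC _)]

lemma isProbabilityMeasure_rieszMeasure {α R C : ℝ} (hα3 : α < 3) (hR : 0 < R)
    (hC : C = ProbabilityTheory.beta (1 / 2) ((3 - α) / 2)) :
    IsProbabilityMeasure (rieszMeasure α R C) := by
  have hC0 : 0 < C := hC ▸ ProbabilityTheory.beta_pos one_half_pos (by linarith)
  have h1 : ∫ x, rieszDensity α R C x = 1 := by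
    have h := integral_rieszDensity_mul (α := α) (C := C) hR (fun _ => 1)
    have hb := (even_beta_integral (r := 0) (q := (3 - α) / 2) (by norm_num) (by linarith)).2
    simp only [rpow_zero, one_mul, zero_add, ← hC,
      show (3 - α) / 2 - 1 = -(α - 1) / 2 by ring] at hb
    simp only [mul_one, one_mul, hb, inv_mul_cancel₀ hC0.ne'] at h
    exact h
  have hint : Integrable (rieszDensity α R C) := by
    by_contra h
    rw [integral_undef h] at h1
    exact zero_ne_one h1
  constructor
  rw [rieszMeasure, withDensity_apply _ MeasurableSet.univ, Measure.restrict_univ,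
    ← ofReal_integral_eq_lintegral_ofReal hint
      (Filter.Eventually.of_forall (rieszDensity_nonneg hR hC0)), h1, ENNReal.ofReal_one]

lemma rieszMeasure_eq_zero_of_forall_le_abs {α R C : ℝ} {s : Set ℝ} (hs : MeasurableSet s)
    (h : ∀ x ∈ s, R ≤ |x|) : rieszMeasure α R C s = 0 := by
  rw [rieszMeasure, withDensity_apply _ hs, setLIntegral_eq_zero hs]
  intro x hx
  simp [rieszDensity, not_lt.2 (h x hx)]

lemma ae_rieszMeasure_abs_le (α R C : ℝ) : ∀ᵐ y ∂(rieszMeasure α R C), |y| ≤ R := by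
  refine rieszMeasure_eq_zero_of_forall_le_abs ?_ fun x hx => ?_
  · exact (measurableSet_le (by fun_prop) (by fun_prop)).compl
  · exact (not_le.1 (show ¬ |x| ≤ R from hx)).le

lemma abs_le_of_mem_measureSupport {α R C x : ℝ}
    (hx : x ∈ measureSupport (rieszMeasure α R C)) : |x| ≤ R := by
  by_contra! h
  have ho : IsOpen {y : ℝ | R < |y|} := isOpen_lt continuous_const continuous_abs
  exact hx _ (ho.mem_nhds h)
    (rieszMeasure_eq_zero_of_forall_le_abs ho.measurableSet fun y hy => le_of_lt hy)

section Potential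

variable {α R C : ℝ}

lemma integral_abs_sub_rpow_of_abs_lt (hα2 : 2 < α) (hα3 : α < 3) (hR : 0 < R) (hC : 0 < C)
    {x : ℝ} (hx : |x| < R) :
    ∫ y, |x - y| ^ (α - 2) ∂(rieszMeasure α R C) =
      C⁻¹ * R ^ (α - 2) * ProbabilityTheory.beta ((α - 1) / 2) ((3 - α) / 2) := by
  have hz : |x / R| < 1 := by rwa [abs_div, abs_of_pos hR, div_lt_one hR]
  have h := riesz_integral_eq_beta (a := α - 2) (by linarith) (by linarith) hz
  rw [show α - 2 + 1 = α - 1 by ring, show 1 - (α - 2) = 3 - α by ring] at h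
  rw [integral_rieszMeasure hR hC, ← h, mul_assoc]
  congr 1
  rw [← integral_const_mul]
  refine integral_congr_ae (Filter.Eventually.of_forall fun t => ?_)
  simp only
  rw [show x - R * t = R * (x / R - t) by field_simp, abs_mul, abs_of_pos hR,
    mul_rpow hR.le (abs_nonneg _), mul_assoc]

lemma le_integral_abs_sub_rpow [IsFiniteMeasure (rieszMeasure α R C)]
    (hα2 : 2 < α) (hα3 : α < 3) (hR : 0 < R) (hC : 0 < C) (x : ℝ) :
    C⁻¹ * R ^ (α - 2) * ProbabilityTheory.beta ((α - 1) / 2) ((3 - α) / 2) ≤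
      ∫ y, |x - y| ^ (α - 2) ∂(rieszMeasure α R C) := by
  have hk : Continuous fun z : ℝ => |z| ^ (α - 2) :=
    continuous_abs.rpow_const fun _ => Or.inr (by linarith)
  have hae := ae_rieszMeasure_abs_le α R C
  have hcl : closure (Set.Ioo (-R) R) ⊆ {x | ∫ y, |x - y| ^ (α - 2) ∂(rieszMeasure α R C) =
      C⁻¹ * R ^ (α - 2) * ProbabilityTheory.beta ((α - 1) / 2) ((3 - α) / 2)} :=
    closure_minimal
      (fun x hx => integral_abs_sub_rpow_of_abs_lt hα2 hα3 hR hC (abs_lt.2 hx))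
      (isClosed_eq (continuous_integral_comp_sub hae hk) continuous_const)
  rw [closure_Ioo (by linarith)] at hcl
  have hle : ∀ z ∈ Set.Icc (-R) R, (∀ y, |y| ≤ R → |z - y| ≤ |x - y|) →
      C⁻¹ * R ^ (α - 2) * ProbabilityTheory.beta ((α - 1) / 2) ((3 - α) / 2) ≤
      ∫ y, |x - y| ^ (α - 2) ∂(rieszMeasure α R C) := by
    intro z hz hzy
    rw [← hcl hz]
    refine integral_mono_ae (integrable_comp_sub_of_continuous hae hk z)
      (integrable_comp_sub_of_continuous hae hk x) ?_
    filter_upwards [hae] with y hy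
    exact Real.rpow_le_rpow (abs_nonneg _) (hzy y hy) (by linarith)
  rcases lt_or_ge x (-R) with h1 | h1
  · refine hle (-R) ⟨le_rfl, by linarith⟩ fun y hy => ?_
    rw [abs_le] at hy
    rw [abs_of_nonpos (by linarith), abs_of_nonpos (by linarith)]
    linarith
  rcases le_or_gt x R with h2 | h2
  · exact hle x ⟨h1, h2⟩ fun y _ => le_rfl
  · refine hle R ⟨by linarith, le_rfl⟩ fun y hy => ?_
    rw [abs_le] at hy
    rw [abs_of_nonneg (by linarith), abs_of_nonneg (by linarith)]
    linarith

lemma continuous_potential_kernel (hα : 0 < α) :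
    Continuous fun z : ℝ => α⁻¹ * |z| ^ α - 2⁻¹ * |z| ^ 2 :=
  ((continuous_abs.rpow_const fun _ => Or.inr hα.le).const_mul _).sub (by fun_prop)

lemma hasDerivAt_potential_kernel (hα : 2 < α) (z : ℝ) :
    HasDerivAt (fun z : ℝ => α⁻¹ * |z| ^ α - 2⁻¹ * |z| ^ 2) (|z| ^ (α - 2) * z - z) z := by
  have h1 := (hasDerivAt_abs_rpow z (p := α) (by linarith)).const_mul α⁻¹
  have h2 := (hasDerivAt_pow 2 z).const_mul (2⁻¹ : ℝ)
  simp only [sq_abs]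
  refine (h1.sub h2).congr_deriv ?_
  field_simp
  push_cast
  ring

lemma hasDerivAt_deriv_potential_kernel (hα : 2 < α) (z : ℝ) :
    HasDerivAt (fun z : ℝ => |z| ^ (α - 2) * z - z) ((α - 1) * |z| ^ (α - 2) - 1) z := by
  refine ((hasDerivAt_abs_rpow_mul_self (a := α - 2) (by linarith) z).sub
    (hasDerivAt_id z)).congr_deriv ?_
  ring

lemma potential_zero (hα2 : 2 < α) (hα3 : α < 3) (hR : 0 < R)
    (hC : C = ProbabilityTheory.beta (1 / 2) ((3 - α) / 2))
    (hRC : (α - 1) * (C⁻¹ * R ^ (α - 2) *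
      ProbabilityTheory.beta ((α - 1) / 2) ((3 - α) / 2)) = 1) :
    ∫ y, (α⁻¹ * |0 - y| ^ α - 2⁻¹ * |0 - y| ^ 2) ∂(rieszMeasure α R C) =
      -((α - 2) / (α * (4 - α))) * R ^ 2 := by
  have hC0 : 0 < C := hC ▸ ProbabilityTheory.beta_pos one_half_pos (by linarith)
  obtain ⟨i1, e1⟩ := even_beta_integral (r := α) (q := (3 - α) / 2) (by linarith) (by linarith)
  obtain ⟨i2, e2⟩ := even_beta_integral (r := 2) (q := (3 - α) / 2) (by linarith) (by linarith)
  rw [beta_add_one_half_eq (by linarith)] at e1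
  rw [show ((2 : ℝ) + 1) / 2 = 3 / 2 by norm_num, beta_three_halves_eq hα3, ← hC] at e2
  rw [integral_rieszMeasure hR hC0]
  have hRα : R ^ α = R ^ 2 * R ^ (α - 2) := by
    rw [← Real.rpow_natCast, ← Real.rpow_add hR]
    congr 1; push_cast; ring
  have hcongr : ∀ t : ℝ, (α⁻¹ * |0 - R * t| ^ α - 2⁻¹ * |0 - R * t| ^ 2) *
      (1 - t ^ 2) ^ (-(α - 1) / 2) =
      α⁻¹ * (R ^ 2 * R ^ (α - 2)) * (|t| ^ α * (1 - t ^ 2) ^ ((3 - α) / 2 - 1)) -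
      2⁻¹ * R ^ 2 * (|t| ^ (2 : ℝ) * (1 - t ^ 2) ^ ((3 - α) / 2 - 1)) := by
    intro t
    rw [zero_sub, abs_neg, abs_mul, abs_of_pos hR, mul_rpow hR.le (abs_nonneg t), hRα,
      show (3 - α) / 2 - 1 = -(α - 1) / 2 by ring, Real.rpow_two]
    ring
  simp only [hcongr]
  rw [integral_sub (i1.const_mul _) (i2.const_mul _), integral_const_mul, integral_const_mul,
    e1, e2]
  have h4 : 4 - α ≠ 0 := by linarith
  have hα : α ≠ 0 := by linarith
  have hCne := hC0.ne'
  have : (α - 1) * (R ^ (α - 2) *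
      ProbabilityTheory.beta ((α - 1) / 2) ((3 - α) / 2)) = C := by
    field_simp at hRC
    linarith
  field_simp
  linear_combination (4 - α) * this

lemma potential_min_and_const [IsProbabilityMeasure (rieszMeasure α R C)]
    (hα2 : 2 < α) (hα3 : α < 3) (hR : 0 < R) (hC : 0 < C)
    (hRC : (α - 1) * (C⁻¹ * R ^ (α - 2) *
      ProbabilityTheory.beta ((α - 1) / 2) ((3 - α) / 2)) = 1) :
    (∀ x, ∫ y, (α⁻¹ * |0 - y| ^ α - 2⁻¹ * |0 - y| ^ 2) ∂(rieszMeasure α R C) ≤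
      ∫ y, (α⁻¹ * |x - y| ^ α - 2⁻¹ * |x - y| ^ 2) ∂(rieszMeasure α R C)) ∧
    ∀ x, |x| ≤ R → ∫ y, (α⁻¹ * |x - y| ^ α - 2⁻¹ * |x - y| ^ 2) ∂(rieszMeasure α R C) =
      ∫ y, (α⁻¹ * |0 - y| ^ α - 2⁻¹ * |0 - y| ^ 2) ∂(rieszMeasure α R C) := by
  have hae := ae_rieszMeasure_abs_le α R C
  have hkc : Continuous fun z : ℝ => |z| ^ (α - 2) :=
    continuous_abs.rpow_const fun _ => Or.inr (by linarith)
  have hsecond : ∀ x, ∫ y, ((α - 1) * |x - y| ^ (α - 2) - 1) ∂(rieszMeasure α R C) =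
      (α - 1) * ∫ y, |x - y| ^ (α - 2) ∂(rieszMeasure α R C) - 1 := fun x => by
    rw [integral_sub ((integrable_comp_sub_of_continuous hae hkc x).const_mul _)
      (integrable_const 1), integral_const_mul]
    simp
  have hfirst : ∫ y, (|0 - y| ^ (α - 2) * (0 - y) - (0 - y)) ∂(rieszMeasure α R C) = 0 := by
    rw [integral_rieszMeasure hR hC, setIntegral_Ioo_eq_zero_of_odd, mul_zero]
    intro t
    simp only [zero_sub, mul_neg, neg_neg, abs_neg, even_two.neg_pow]
    ring
  have hU := hasDerivAt_integral_comp_sub hae (hasDerivAt_potential_kernel hα2)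
    ((hkc.mul continuous_id).sub continuous_id)
  have hU' := hasDerivAt_integral_comp_sub hae (hasDerivAt_deriv_potential_kernel hα2)
    ((hkc.const_mul _).sub continuous_const)
  refine min_and_const_of_second_deriv hR hU hU' (fun x => ?_) (fun x hx => ?_) hfirst
  · have hα1 : 0 ≤ α - 1 := by linarith
    rw [hsecond, sub_nonneg]
    exact hRC.ge.trans
      (mul_le_mul_of_nonneg_left (le_integral_abs_sub_rpow hα2 hα3 hR hC x) hα1)
  · rw [hsecond, integral_abs_sub_rpow_of_abs_lt hα2 hα3 hR hC hx, hRC, sub_self]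

end Potential

/-- Corollary 2.3. For `2 < α < 3`, the measure
`dμ(x) = C_α⁻¹ R_α^(α-2) (R_α² - x²)^(-(α-1)/2) 𝟙(|x| < R_α) dx` is a Borel probability
measure on `ℝ`, and its potential `φ_α(x) = ∫ (α⁻¹ |x-y|^α - 2⁻¹ |x-y|²) dμ(y)` satisfies
`φ_α ≥ η` on `ℝ` and `φ_α = η` on `supp μ`, with `η = -((α-2)/(α(4-α))) R_α²`. -/
theorem explicit_measure_satisfies_euler_lagrange_two_lt_alpha_lt_three
    (α : ℝ) (hα2 : 2 < α) (hα3 : α < 3)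
    (Rα Cα η : ℝ)
    (hR : Rα = ((Real.sqrt π / 2) * (Real.Gamma ((3 - α) / 2) / Real.Gamma ((4 - α) / 2)) *
      (Real.sin ((α - 1) * π / 2) / ((α - 1) * π / 2))) ^ (1 / (α - 2)))
    (hC : Cα = Real.sqrt π * Real.Gamma ((3 - α) / 2) / Real.Gamma ((4 - α) / 2))
    (hη : η = -((α - 2) / (α * (4 - α))) * Rα ^ 2)
    (μ : Measure ℝ)
    (hμ : μ = volume.withDensity fun x => ENNReal.ofReal
      (if |x| < Rα then Cα⁻¹ * Rα ^ (α - 2) * (Rα ^ 2 - x ^ 2) ^ (-(α - 1) / 2) else 0)) :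
    IsProbabilityMeasure μ ∧
    (∀ x : ℝ, Integrable (fun y => α⁻¹ * |x - y| ^ α - 2⁻¹ * |x - y| ^ 2) μ) ∧
    (∀ x : ℝ, η ≤ ∫ y, (α⁻¹ * |x - y| ^ α - 2⁻¹ * |x - y| ^ 2) ∂μ) ∧
    (∀ x ∈ measureSupport μ,
      ∫ y, (α⁻¹ * |x - y| ^ α - 2⁻¹ * |x - y| ^ 2) ∂μ = η) := by
  change μ = rieszMeasure α Rα Cα at hμ
  subst hμ
  have hCb : Cα = ProbabilityTheory.beta (1 / 2) ((3 - α) / 2) := hC.trans (beta_half_eq α).symm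
  have hC0 : 0 < Cα := hCb ▸ ProbabilityTheory.beta_pos one_half_pos (by linarith)
  have hsin : 0 < sin ((α - 1) * π / 2) :=
    sin_pos_of_pos_of_lt_pi (by nlinarith [pi_pos]) (by nlinarith [pi_pos])
  have hα1 : 0 < α - 1 := by linarith
  have hbase : (Real.sqrt π / 2) * (Real.Gamma ((3 - α) / 2) / Real.Gamma ((4 - α) / 2)) *
      (Real.sin ((α - 1) * π / 2) / ((α - 1) * π / 2)) =
      Cα * sin ((α - 1) * π / 2) / ((α - 1) * π) := by
    rw [hC]
    field_simp
  have hbase0 : 0 < Cα * sin ((α - 1) * π / 2) / ((α - 1) * π) := by positivity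
  rw [hbase] at hR
  have hR0 : 0 < Rα := hR ▸ Real.rpow_pos_of_pos hbase0 _
  have hRpow : Rα ^ (α - 2) = Cα * sin ((α - 1) * π / 2) / ((α - 1) * π) := by
    rw [hR, ← Real.rpow_mul hbase0.le, one_div_mul_cancel (by linarith), Real.rpow_one]
  have hRC : (α - 1) * (Cα⁻¹ * Rα ^ (α - 2) *
      ProbabilityTheory.beta ((α - 1) / 2) ((3 - α) / 2)) = 1 := by
    rw [hRpow, beta_sub_one_half_eq]
    field_simp
  have hprob : IsProbabilityMeasure (rieszMeasure α Rα Cα) :=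
    isProbabilityMeasure_rieszMeasure hα3 hR0 hCb
  have hae := ae_rieszMeasure_abs_le α Rα Cα
  obtain ⟨hmin, hconst⟩ := potential_min_and_const hα2 hα3 hR0 hC0 hRC
  rw [potential_zero hα2 hα3 hR0 hCb hRC, ← hη] at hmin hconst
  have hkc := continuous_potential_kernel (α := α) (by linarith)
  exact ⟨hprob,
    fun x => integrable_comp_sub_of_continuous hae hkc x,
    hmin, fun x hx => hconst x (abs_le_of_mem_measureSupport hx)⟩
end
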